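/- Let n = 2m and let f1, f2, f3 be bent functions in n variables and f4 = f1 + f2 + f3, such that: (1) there is an m-dimensional subspace U of F_2^n which, for each i = 1,…,4, is the unique m-dimensional M-subspace of f_i; (2) f = f1||f2||f3||f4 is a bent function in n+2 variables; (3) every (m−1)-dimensional subspace V of F_2^n that is an M-subspace of all of f1, f2, f3, f4 satisfies V ⊆ U. Suppose there exists a 2-dimensional subspace S ⊆ U such that for every nonzero u ∈ S and every v ∈ F_2^n, each of the three functions x ↦ D_u f1(x) + D_u f2(x+v), x ↦ D_u f1(x) + D_u f3(x+v), and x ↦ D_u f2(x) + D_u f3(x+v) is not identically zero. Then f has no (m+1)-dimensional M-subspace; i.e., f is outside the completed Maiorana–McFarland class MM^#. -/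

import Mathlib

open scoped BigOperators

/-- The vector space `F_2^n`. -/
abbrev BV (n : ℕ) := Fin n → ZMod 2

/-- Dot product on `F_2^n`. -/
def dotp {n : ℕ} (x y : BV n) : ZMod 2 := ∑ i, x i * y i

/-- `W` is an M-subspace of `f` : all second-order derivatives of `f` in directions
from `W` vanish identically. -/
def IsMSub {M : Type} [AddCommGroup M] [Module (ZMod 2) M] (f : M → ZMod 2)
    (W : Submodule (ZMod 2) M) : Prop :=
  ∀ a ∈ W, ∀ b ∈ W, ∀ x, f x + f (x + a) + f (x + b) + f (x + a + b) = 0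


/-- The bent 4-concatenation `f = f1 || f2 || f3 || f4`:
`f (x, y1, y2) = f1 x + y1 (f1 x + f3 x) + y2 (f1 x + f2 x)
  + y1 y2 (f1 x + f2 x + f3 x + f4 x)`. -/
def concat {X : Type} (f1 f2 f3 f4 : X → ZMod 2) :
    X × (ZMod 2 × ZMod 2) → ZMod 2 :=
  fun p =>
    f1 p.1 + p.2.1 * (f1 p.1 + f3 p.1) + p.2.2 * (f1 p.1 + f2 p.1)
      + p.2.1 * p.2.2 * (f1 p.1 + f2 p.1 + f3 p.1 + f4 p.1)

/-- Walsh–Hadamard transform of `f : F_2^n → F_2` at `a`. -/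
def walsh {n : ℕ} (f : BV n → ZMod 2) (a : BV n) : ℤ :=
  ∑ x : BV n, (-1 : ℤ) ^ (f x + dotp a x).val

/-- Walsh–Hadamard transform of a function on `F_2^n × F_2 × F_2` at `a`. -/
def walshC {n : ℕ} (f : BV n × (ZMod 2 × ZMod 2) → ZMod 2)
    (a : BV n × (ZMod 2 × ZMod 2)) : ℤ :=
  ∑ p : BV n × (ZMod 2 × ZMod 2),
    (-1 : ℤ) ^ (f p + dotp a.1 p.1 + a.2.1 * p.2.1 + a.2.2 * p.2.2).val

/-- Between nested finite-dimensional subspaces there are subspaces of every intermediate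
dimension. -/
theorem Submodule.exists_between_finrank_eq {K V : Type*} [DivisionRing K] [AddCommGroup V]
    [Module K V] [Module.Finite K V] {P Q : Submodule K V} (hPQ : P ≤ Q) {k : ℕ}
    (hP : Module.finrank K P ≤ k) (hQ : k ≤ Module.finrank K Q) :
    ∃ R : Submodule K V, P ≤ R ∧ R ≤ Q ∧ Module.finrank K R = k := by
  induction k, hP using Nat.le_induction with
  | base => exact ⟨P, le_rfl, hPQ, rfl⟩
  | succ k _ ih =>
    obtain ⟨R, hPR, hRQ, hR⟩ := ih (by omega)
    obtain ⟨v, hvQ, hvR⟩ : ∃ v ∈ Q, v ∉ R := by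
      by_contra! h
      have := Submodule.finrank_mono (show Q ≤ R from h)
      omega
    refine ⟨R ⊔ K ∙ v, hPR.trans le_sup_left, sup_le hRQ ?_, ?_⟩
    · rwa [Submodule.span_singleton_le_iff_mem]
    · rw [Submodule.finrank_sup_span_singleton hvR, hR]

theorem finrank_comap_inl {K V V' : Type*} [DivisionRing K] [AddCommGroup V] [Module K V]
    [AddCommGroup V'] [Module K V'] (W : Submodule K (V × V')) :
    Module.finrank K (W.comap (LinearMap.inl K V V')) =
      Module.finrank K ↥(LinearMap.range (LinearMap.inl K V V') ⊓ W) := by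
  rw [← Submodule.map_comap_eq]
  exact (Submodule.equivMapOfInjective _ LinearMap.inl_injective _).finrank_eq

theorem finrank_le_finrank_comap_inl_add {K V V' : Type*} [DivisionRing K] [AddCommGroup V]
    [Module K V] [Module.Finite K V] [AddCommGroup V'] [Module K V'] [Module.Finite K V']
    (W : Submodule K (V × V')) :
    Module.finrank K W ≤
      Module.finrank K (W.comap (LinearMap.inl K V V')) + Module.finrank K V' := by
  have h₁ := Submodule.finrank_sup_add_finrank_inf_eq (LinearMap.range (LinearMap.inl K V V')) W
  have h₂ := Submodule.finrank_le (LinearMap.range (LinearMap.inl K V V') ⊔ W)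
  have h₃ := LinearMap.finrank_range_of_inj (LinearMap.inl_injective (R := K) (M := V) (M₂ := V'))
  rw [Module.finrank_prod] at h₂
  rw [finrank_comap_inl]
  omega

theorem IsMSub.mono {M : Type} [AddCommGroup M] [Module (ZMod 2) M] {f : M → ZMod 2}
    {V W : Submodule (ZMod 2) M} (hW : IsMSub f W) (h : V ≤ W) : IsMSub f V :=
  fun a ha b hb x => hW a (h ha) b (h hb) x

section Concat

variable {X : Type} (f1 f2 f3 f4 : X → ZMod 2) (x : X)

theorem concat_zero_zero : concat f1 f2 f3 f4 (x, 0, 0) = f1 x := by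
  simp [concat]

theorem concat_zero_one : concat f1 f2 f3 f4 (x, 0, 1) = f2 x := by
  simp [concat, ← add_assoc, CharTwo.add_self_eq_zero]

theorem concat_one_zero : concat f1 f2 f3 f4 (x, 1, 0) = f3 x := by
  simp [concat, ← add_assoc, CharTwo.add_self_eq_zero]

theorem concat_one_one : concat f1 f2 f3 f4 (x, 1, 1) = f4 x := by
  simp only [concat]
  generalize f1 x = a, f2 x = b, f3 x = c, f4 x = d
  revert a b c d
  decide

end Concat

theorem IsMSub.comap_inl {X : Type} [AddCommGroup X] [Module (ZMod 2) X]
    {f1 f2 f3 f4 : X → ZMod 2} {W : Submodule (ZMod 2) (X × (ZMod 2 × ZMod 2))}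
    (hW : IsMSub (concat f1 f2 f3 f4) W) :
    IsMSub f1 (W.comap (LinearMap.inl (ZMod 2) X (ZMod 2 × ZMod 2))) ∧
    IsMSub f2 (W.comap (LinearMap.inl (ZMod 2) X (ZMod 2 × ZMod 2))) ∧
    IsMSub f3 (W.comap (LinearMap.inl (ZMod 2) X (ZMod 2 × ZMod 2))) ∧
    IsMSub f4 (W.comap (LinearMap.inl (ZMod 2) X (ZMod 2 × ZMod 2))) := by
  refine ⟨fun a ha b hb x => ?_, fun a ha b hb x => ?_, fun a ha b hb x => ?_,
    fun a ha b hb x => ?_⟩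
  · simpa [concat_zero_zero] using hW _ ha _ hb (x, 0, 0)
  · simpa [concat_zero_one] using hW _ ha _ hb (x, 0, 1)
  · simpa [concat_one_zero] using hW _ ha _ hb (x, 1, 0)
  · simpa [concat_one_one] using hW _ ha _ hb (x, 1, 1)

/-- If an M-subspace of `f1 || f2 || f3 || f4` contains `(u, 0)` and some `(v, y)` with `y ≠ 0`,
then two of `D_u f1`, `D_u f2`, `D_u f3` are translates of each other by `v`. -/
theorem IsMSub.exists_derivative_eq_translate {X : Type} [AddCommGroup X] [Module (ZMod 2) X]
    {f1 f2 f3 f4 : X → ZMod 2} {W : Submodule (ZMod 2) (X × (ZMod 2 × ZMod 2))}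
    (hW : IsMSub (concat f1 f2 f3 f4) W) {u v : X} {y : ZMod 2 × ZMod 2}
    (hu : (u, 0) ∈ W) (hv : (v, y) ∈ W) (hy : y ≠ 0) :
    (∀ x, (f1 (x + u) + f1 x) + (f2 (x + v + u) + f2 (x + v)) = 0) ∨
    (∀ x, (f1 (x + u) + f1 x) + (f3 (x + v + u) + f3 (x + v)) = 0) ∨
    (∀ x, (f2 (x + u) + f2 x) + (f3 (x + v + u) + f3 (x + v)) = 0) := by
  have key (x : X) (z : ZMod 2 × ZMod 2) :
      (concat f1 f2 f3 f4 (x + u, z) + concat f1 f2 f3 f4 (x, z)) +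
        (concat f1 f2 f3 f4 (x + v + u, z + y) + concat f1 f2 f3 f4 (x + v, z + y)) = 0 := by
    have h := hW _ hu _ hv (x, z)
    simp only [Prod.mk_add_mk, add_zero] at h
    rw [← h, add_right_comm x v u]
    ring
  have hcases : ∀ y : ZMod 2 × ZMod 2, y ≠ 0 → y = (0, 1) ∨ y = (1, 0) ∨ y = (1, 1) := by
    decide
  rcases hcases y hy with rfl | rfl | rfl
  · refine .inl fun x => ?_
    simpa [concat_zero_zero, concat_zero_one] using key x (0, 0)
  · refine .inr (.inl fun x => ?_)
    simpa [concat_zero_zero, concat_one_zero] using key x (0, 0)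
  · refine .inr (.inr fun x => ?_)
    have h := key x (0, 1)
    rw [show ((0, 1) : ZMod 2 × ZMod 2) + (1, 1) = (1, 0) by decide] at h
    simpa only [concat_zero_one, concat_one_zero] using h

theorem stmt18 {n m : ℕ} (hnm : n = 2 * m)
    (f1 f2 f3 f4 : BV n → ZMod 2)
    (hf4 : ∀ x, f4 x = f1 x + f2 x + f3 x)
    (hb1 : ∀ a, walsh f1 a = 2 ^ m ∨ walsh f1 a = -(2 ^ m))
    (hb2 : ∀ a, walsh f2 a = 2 ^ m ∨ walsh f2 a = -(2 ^ m))
    (hb3 : ∀ a, walsh f3 a = 2 ^ m ∨ walsh f3 a = -(2 ^ m))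
    (U : Submodule (ZMod 2) (BV n)) (hUdim : Module.finrank (ZMod 2) ↥U = m)
    (hU1 : IsMSub f1 U ∧ ∀ W : Submodule (ZMod 2) (BV n),
      Module.finrank (ZMod 2) ↥W = m → IsMSub f1 W → W = U)
    (hU2 : IsMSub f2 U ∧ ∀ W : Submodule (ZMod 2) (BV n),
      Module.finrank (ZMod 2) ↥W = m → IsMSub f2 W → W = U)
    (hU3 : IsMSub f3 U ∧ ∀ W : Submodule (ZMod 2) (BV n),
      Module.finrank (ZMod 2) ↥W = m → IsMSub f3 W → W = U)
    (hU4 : IsMSub f4 U ∧ ∀ W : Submodule (ZMod 2) (BV n),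
      Module.finrank (ZMod 2) ↥W = m → IsMSub f4 W → W = U)
    (hbent : ∀ a, walshC (concat f1 f2 f3 f4) a = 2 ^ (m + 1) ∨
      walshC (concat f1 f2 f3 f4) a = -(2 ^ (m + 1)))
    (hVU : ∀ V : Submodule (ZMod 2) (BV n),
      Module.finrank (ZMod 2) ↥V = m - 1 →
      IsMSub f1 V → IsMSub f2 V → IsMSub f3 V → IsMSub f4 V → V ≤ U)
    (hS : ∃ S : Submodule (ZMod 2) (BV n), S ≤ U ∧ Module.finrank (ZMod 2) ↥S = 2 ∧
      ∀ u ∈ S, u ≠ 0 → ∀ v : BV n,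
        (¬ ∀ x, (f1 (x + u) + f1 x) + (f2 (x + v + u) + f2 (x + v)) = 0) ∧
        (¬ ∀ x, (f1 (x + u) + f1 x) + (f3 (x + v + u) + f3 (x + v)) = 0) ∧
        (¬ ∀ x, (f2 (x + u) + f2 x) + (f3 (x + v + u) + f3 (x + v)) = 0)) :
    ¬ ∃ W : Submodule (ZMod 2) (BV n × (ZMod 2 × ZMod 2)),
      Module.finrank (ZMod 2) ↥W = m + 1 ∧ IsMSub (concat f1 f2 f3 f4) W := by
  rintro ⟨W, hWdim, hW⟩
  obtain ⟨S, hSU, hSdim, hS⟩ := hS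
  have hm : 2 ≤ m := by
    rw [← hSdim, ← hUdim]
    exact Submodule.finrank_mono hSU
  obtain ⟨hW1, hW2, hW3, hW4⟩ := hW.comap_inl
  have hdim := finrank_le_finrank_comap_inl_add W
  have hinl := finrank_comap_inl W
  set W₀ := W.comap (LinearMap.inl (ZMod 2) (BV n) (ZMod 2 × ZMod 2))
  rw [Module.finrank_prod, Module.finrank_self, hWdim] at hdim
  obtain ⟨⟨v, y⟩, hvW, hy⟩ : ∃ p ∈ W, p.2 ≠ 0 := by
    by_contra! h
    have hle : W ≤ LinearMap.range (LinearMap.inl (ZMod 2) (BV n) (ZMod 2 × ZMod 2)) :=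
      fun p hp => ⟨p.1, Prod.ext rfl (h p hp).symm⟩
    rw [inf_eq_right.mpr hle, hWdim] at hinl
    obtain ⟨w, hw, hwU⟩ : ∃ w ∈ W₀, w ∉ U := by
      by_contra! h
      have := Submodule.finrank_mono (show W₀ ≤ U from h)
      omega
    have hspan := finrank_span_singleton (K := ZMod 2)
      (ne_of_mem_of_not_mem U.zero_mem hwU).symm
    obtain ⟨R, hwR, hRW, hR⟩ := Submodule.exists_between_finrank_eq
      ((Submodule.span_singleton_le_iff_mem w W₀).mpr hw) (k := m) (by omega) (by omega)
    rw [← hU1.2 R hR (hW1.mono hRW)] at hwU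
    exact hwU ((Submodule.span_singleton_le_iff_mem w R).mp hwR)
  obtain ⟨V, -, hVW, hV⟩ := Submodule.exists_between_finrank_eq (bot_le (a := W₀)) (k := m - 1)
    (by simp) (by omega)
  have hVleU := hVU V hV (hW1.mono hVW) (hW2.mono hVW) (hW3.mono hVW) (hW4.mono hVW)
  have hne : S ⊓ V ≠ ⊥ := by
    intro h
    have h₁ := Submodule.finrank_sup_add_finrank_inf_eq S V
    have h₂ := Submodule.finrank_mono (sup_le hSU hVleU)
    rw [h, finrank_bot] at h₁
    omega
  obtain ⟨u, ⟨huS, huV⟩, hu⟩ := Submodule.exists_mem_ne_zero_of_ne_bot hne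
  obtain ⟨h12, h13, h23⟩ := hS u huS hu v
  rcases hW.exists_derivative_eq_translate (hVW huV) hvW hy with h | h | h
  exacts [h12 h, h13 h, h23 h]
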